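/- For each 1 < q < 2 there exists a compact set E ⊂ ℂ which is uniformly perfect and satisfies C_q(E) > 0 and C_{q'}(E) = 0 for every q' ∈ (1, q). -/

import Mathlib

open MeasureTheory Metric Complex Filter

noncomputable section

/-- The `q`-capacity `C_q(E) = inf { ∫_ℂ |∇φ|^q : φ ∈ C_c^∞(ℂ,ℝ), φ ≥ 1 on E }`. -/
def capacity (q : ℝ) (E : Set ℂ) : ℝ :=
  sInf { t : ℝ | ∃ φ : ℂ → ℝ, ContDiff ℝ (⊤ : ℕ∞) φ ∧ HasCompactSupport φ ∧
    (∀ x ∈ E, 1 ≤ φ x) ∧ t = ∫ x : ℂ, ‖fderiv ℝ φ x‖ ^ q }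

theorem setIntegral_unitBall_comp_affine (h : ℂ → ℝ) (c : ℂ) {r : ℝ} (hr : 0 < r) :
    ∫ u in ball (0 : ℂ) 1, h (c + r • u) = (r ^ 2)⁻¹ * ∫ x in ball c r, h x := by
  rw [Measure.setIntegral_comp_smul_of_pos volume (fun y => h (c + y)) _ hr, smul_unitBall hr.ne',
    Real.norm_of_nonneg hr.le, Complex.finrank_real_complex, smul_eq_mul]
  congr 1
  have := (measurePreserving_add_left (volume : Measure ℂ) c).setIntegral_preimage_emb
    (measurableEmbedding_addLeft c) h (ball c r)
  rw [← this]
  congr 2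
  ext x
  simp

theorem sum_setIntegral_unitBall_comp_affine_le {ι : Type*} (T : Finset ι) (c : ι → ℂ) {r : ℝ}
    (hr : 0 < r) (hsep : ∀ i ∈ T, ∀ j ∈ T, i ≠ j → 2 * r ≤ dist (c i) (c j))
    {h : ℂ → ℝ} (h_int : Integrable h) (h_nonneg : ∀ x, 0 ≤ h x) :
    ∑ i ∈ T, ∫ u in ball (0 : ℂ) 1, h (c i + r • u) ≤ (r ^ 2)⁻¹ * ∫ x, h x := by
  simp_rw [setIntegral_unitBall_comp_affine h _ hr, ← Finset.mul_sum]
  gcongr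
  rw [← integral_biUnion_finset T (fun i _ => measurableSet_ball) ?_
    (fun i _ => h_int.integrableOn)]
  · exact setIntegral_le_integral h_int (ae_of_all _ h_nonneg)
  · intro i hi j hj hij
    exact ball_disjoint_ball (by linarith [hsep i hi j hj hij])

theorem le_add_rpow_mul_rpow {q g δ : ℝ} (hq : 1 < q) (hg : 0 ≤ g) (hδ : 0 < δ) :
    g ≤ δ + δ ^ (1 - q) * g ^ q := by
  rcases le_or_gt g δ with h | h
  · have : 0 ≤ δ ^ (1 - q) * g ^ q := by positivity
    linarith
  · have hg' : 0 < g := hδ.trans h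
    have h1 : g ^ (1 - q) ≤ δ ^ (1 - q) :=
      Real.rpow_le_rpow_of_nonpos hδ h.le (by linarith)
    have h2 : g ^ (1 - q) * g ^ q = g := by
      rw [← Real.rpow_add hg']; simp
    nlinarith [Real.rpow_nonneg hg q]

theorem integrable_norm_fderiv_rpow {q : ℝ} (hq : 0 < q) {φ : ℂ → ℝ} (hφ : ContDiff ℝ 1 φ)
    (hc : HasCompactSupport φ) : Integrable (fun x => ‖fderiv ℝ φ x‖ ^ q) := by
  refine Continuous.integrable_of_hasCompactSupport
    ((hφ.continuous_fderiv one_ne_zero).norm.rpow_const fun _ => Or.inr hq.le) ?_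
  refine (hc.fderiv ℝ).mono fun x hx => ?_
  contrapose! hx
  simp only [Function.mem_support, not_not] at hx
  simp [hx, Real.zero_rpow hq.ne']

theorem comp_affine_sub_le {q : ℝ} (hq : 1 < q) {φ : ℂ → ℝ} (hφ : ContDiff ℝ 1 φ)
    {δ : ℝ} (hδ : 0 < δ) {L m : ℝ} (hm : 0 < m) (hmL : m ≤ L) {b : ℂ} (hb : ‖b‖ ≤ L)
    (x : ℂ) {u : ℂ} (hu : ‖u‖ ≤ 1) :
    φ (x + b + m • u) ≤ φ (x + L • u) + 2 * L * (δ + δ ^ (1 - q) *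
      ∫ t in (0 : ℝ)..1, ‖fderiv ℝ φ ((x + t • b) + (L + t * (m - L)) • u)‖ ^ q) := by
  set p : ℝ → ℂ := fun t => (x + t • b) + (L + t * (m - L)) • u with hp
  have hp_cont : Continuous p := by fun_prop
  have hp' : ∀ t, HasDerivAt p (b + (m - L) • u) t := by
    intro t
    have h1 : HasDerivAt (fun t : ℝ => x + t • b) (b) t := by
      simpa using ((hasDerivAt_id t).smul_const b).const_add x
    have h2 : HasDerivAt (fun t : ℝ => (L + t * (m - L)) • u) ((m - L) • u) t := by
      have := (((hasDerivAt_id t).mul_const (m - L)).const_add L).smul_const u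
      simpa using this
    exact h1.add h2
  have hφp : ∀ t, HasDerivAt (fun t => φ (p t)) (fderiv ℝ φ (p t) (b + (m - L) • u)) t :=
    fun t => ((hφ.differentiable one_ne_zero (p t)).hasFDerivAt).comp_hasDerivAt t (hp' t)
  have hg_cont : Continuous fun t => fderiv ℝ φ (p t) :=
    (hφ.continuous_fderiv one_ne_zero).comp hp_cont
  have hq_cont : Continuous fun t => ‖fderiv ℝ φ (p t)‖ ^ q :=
    hg_cont.norm.rpow_const fun _ => Or.inr (by linarith)
  have hv : ‖b + (m - L) • u‖ ≤ 2 * L := by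
    have h1 : ‖(m - L) • u‖ ≤ L := by
      rw [norm_smul, Real.norm_eq_abs, abs_of_nonpos (by linarith)]
      nlinarith [norm_nonneg u]
    linarith [norm_add_le b ((m - L) • u)]
  have hftc := intervalIntegral.integral_eq_sub_of_hasDerivAt (a := 0) (b := 1)
    (fun t _ => hφp t) ((hg_cont.clm_apply continuous_const).intervalIntegrable _ _)
  have hle : ∫ t in (0 : ℝ)..1, fderiv ℝ φ (p t) (b + (m - L) • u) ≤
      ∫ t in (0 : ℝ)..1, 2 * L * (δ + δ ^ (1 - q) * ‖fderiv ℝ φ (p t)‖ ^ q) := by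
    refine intervalIntegral.integral_mono_on zero_le_one
      ((hg_cont.clm_apply continuous_const).intervalIntegrable _ _)
      (Continuous.intervalIntegrable (by fun_prop) _ _) fun t _ => ?_
    calc fderiv ℝ φ (p t) (b + (m - L) • u) ≤ ‖fderiv ℝ φ (p t)‖ * ‖b + (m - L) • u‖ :=
          (le_abs_self _).trans ((fderiv ℝ φ (p t)).le_opNorm _)
      _ ≤ ‖fderiv ℝ φ (p t)‖ * (2 * L) := by gcongr
      _ = 2 * L * ‖fderiv ℝ φ (p t)‖ := by ring
      _ ≤ _ := by
        have : 0 < L := hm.trans_le hmL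
        gcongr
        exact le_add_rpow_mul_rpow hq (norm_nonneg _) hδ
  have heq : ∫ t in (0 : ℝ)..1, 2 * L * (δ + δ ^ (1 - q) * ‖fderiv ℝ φ (p t)‖ ^ q) =
      2 * L * (δ + δ ^ (1 - q) * ∫ t in (0 : ℝ)..1, ‖fderiv ℝ φ (p t)‖ ^ q) := by
    rw [intervalIntegral.integral_const_mul, intervalIntegral.integral_add (by simp)
      (Continuous.intervalIntegrable (by fun_prop) _ _), intervalIntegral.integral_const_mul]
    simp
  have h0 : p 0 = x + L • u := by simp [hp]
  have h1 : p 1 = x + b + m • u := by simp [hp]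
  rw [← h0, ← h1]
  linarith

theorem sum_setIntegral_comp_affine_le {q : ℝ} (hq : 1 < q) {φ : ℂ → ℝ} (hφ : ContDiff ℝ 1 φ)
    (hc : HasCompactSupport φ) {ι : Type*} (T : Finset ι) (x : ι → ℂ)
    {L m : ℝ} (hm : 0 < m) (hmL : m ≤ L) {b : ℂ} (hb : ‖b‖ ≤ L)
    (hsep : ∀ i ∈ T, ∀ j ∈ T, i ≠ j → 2 * L ≤ dist (x i) (x j)) {δ : ℝ} (hδ : 0 < δ) :
    ∑ i ∈ T, ∫ u in ball (0 : ℂ) 1, φ (x i + b + m • u) ≤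
      (∑ i ∈ T, ∫ u in ball (0 : ℂ) 1, φ (x i + L • u)) +
        2 * L * (δ * (T.card * volume.real (ball (0 : ℂ) 1)) +
          δ ^ (1 - q) * ((m ^ 2)⁻¹ * ∫ z, ‖fderiv ℝ φ z‖ ^ q)) := by
  set h : ℂ → ℝ := fun z => ‖fderiv ℝ φ z‖ ^ q with hh
  have h_cont : Continuous h :=
    (hφ.continuous_fderiv one_ne_zero).norm.rpow_const fun _ => Or.inr (by linarith)
  have h_int : Integrable h := integrable_norm_fderiv_rpow (by linarith) hφ hc
  have h_nonneg : ∀ z, 0 ≤ h z := fun z => by positivity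
  have hL : 0 < L := hm.trans_le hmL
  have hball : ∀ {f : ℂ → ℝ}, Continuous f → IntegrableOn f (ball (0 : ℂ) 1) := fun hf =>
    (hf.continuousOn.integrableOn_compact (isCompact_closedBall (0 : ℂ) 1)).mono_set
      ball_subset_closedBall
  have hprod : ∀ i, Integrable (Function.uncurry fun (t : ℝ) (u : ℂ) =>
      h ((x i + t • b) + (L + t * (m - L)) • u))
      ((volume.restrict (Set.uIoc 0 1)).prod (volume.restrict (ball (0 : ℂ) 1))) := by
    intro i
    rw [Measure.prod_restrict]
    refine IntegrableOn.mono_set (t := Set.Icc (0 : ℝ) 1 ×ˢ closedBall (0 : ℂ) 1) ?_ ?_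
    · refine ContinuousOn.integrableOn_compact (isCompact_Icc.prod (isCompact_closedBall _ _)) ?_
      refine Continuous.continuousOn ?_
      simp only [Function.uncurry_def]
      fun_prop
    · rw [Set.uIoc_of_le zero_le_one]
      exact Set.prod_mono Set.Ioc_subset_Icc_self ball_subset_closedBall
  have hstep : ∀ i ∈ T, ∫ u in ball (0 : ℂ) 1, φ (x i + b + m • u) ≤
      (∫ u in ball (0 : ℂ) 1, φ (x i + L • u)) + 2 * L * (δ * volume.real (ball (0 : ℂ) 1) +
        δ ^ (1 - q) * ∫ t in (0 : ℝ)..1, ∫ u in ball (0 : ℂ) 1,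
          h ((x i + t • b) + (L + t * (m - L)) • u)) := by
    intro i _
    have hf_int : IntegrableOn (fun u : ℂ => ∫ t in (0 : ℝ)..1,
        h ((x i + t • b) + (L + t * (m - L)) • u)) (ball (0 : ℂ) 1) := by
      have := (hprod i).integral_prod_right
      simpa only [intervalIntegral.integral_of_le zero_le_one, Set.uIoc_of_le zero_le_one,
        Function.uncurry, IntegrableOn] using this
    rw [intervalIntegral_integral_swap (hprod i)]
    have hφc := hφ.continuous
    have i1 : IntegrableOn (fun u : ℂ => φ (x i + L • u)) (ball (0 : ℂ) 1) := hball (by fun_prop)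
    have i2 : IntegrableOn (fun _ : ℂ => δ) (ball (0 : ℂ) 1) := hball (by fun_prop)
    have i3 := hf_int.const_mul (δ ^ (1 - q))
    have i4 : IntegrableOn (fun u : ℂ => 2 * L * (δ + δ ^ (1 - q) *
        ∫ t in (0 : ℝ)..1, h ((x i + t • b) + (L + t * (m - L)) • u))) (ball (0 : ℂ) 1) :=
      (i2.add i3).const_mul _
    calc ∫ u in ball (0 : ℂ) 1, φ (x i + b + m • u) ≤
        ∫ u in ball (0 : ℂ) 1, (φ (x i + L • u) + 2 * L * (δ + δ ^ (1 - q) *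
          ∫ t in (0 : ℝ)..1, h ((x i + t • b) + (L + t * (m - L)) • u))) := by
          refine setIntegral_mono_on (hball (by fun_prop)) ?_ measurableSet_ball fun u hu => ?_
          · exact i1.add i4
          · exact comp_affine_sub_le hq hφ hδ hm hmL hb (x i) (by simpa using (mem_ball.1 hu).le)
      _ = _ := by
          rw [integral_add i1 i4, integral_const_mul, integral_add i2 i3, integral_const_mul]
          simp [mul_comm]
  have hpack : ∑ i ∈ T, ∫ t in (0 : ℝ)..1, ∫ u in ball (0 : ℂ) 1,
      h ((x i + t • b) + (L + t * (m - L)) • u) ≤ (m ^ 2)⁻¹ * ∫ z, h z := by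
    have hii : ∀ i ∈ T, IntervalIntegrable (fun t : ℝ => ∫ u in ball (0 : ℂ) 1,
        h ((x i + t • b) + (L + t * (m - L)) • u)) volume 0 1 := fun i _ => by
      rw [intervalIntegrable_iff]
      exact (hprod i).integral_prod_left
    rw [← intervalIntegral.integral_finsetSum hii]
    calc _ ≤ ∫ t in (0 : ℝ)..1, (m ^ 2)⁻¹ * ∫ z, h z := by
          refine intervalIntegral.integral_mono_on zero_le_one
            (by simpa only [Finset.sum_fn] using IntervalIntegrable.sum T hii) (by simp) fun t ht => ?_
          have hr : m ≤ L + t * (m - L) := by nlinarith [ht.1, ht.2]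
          have hr' : L + t * (m - L) ≤ L := by nlinarith [ht.1, ht.2]
          refine (sum_setIntegral_unitBall_comp_affine_le T (fun i => x i + t • b)
            (hm.trans_le hr) (fun i hi j hj hij => ?_) h_int h_nonneg).trans ?_
          · rw [dist_add_right]
            linarith [hsep i hi j hj hij]
          · have : 0 ≤ ∫ z, h z := integral_nonneg h_nonneg
            gcongr
      _ = _ := by simp
  calc _ ≤ _ := Finset.sum_le_sum hstep
    _ = (∑ i ∈ T, ∫ u in ball (0 : ℂ) 1, φ (x i + L • u)) +
        2 * L * (δ * (T.card * volume.real (ball (0 : ℂ) 1)) +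
          δ ^ (1 - q) * ∑ i ∈ T, ∫ t in (0 : ℝ)..1, ∫ u in ball (0 : ℂ) 1,
            h ((x i + t • b) + (L + t * (m - L)) • u)) := by
        rw [Finset.sum_add_distrib, ← Finset.mul_sum, Finset.sum_add_distrib, Finset.sum_const,
          ← Finset.mul_sum, nsmul_eq_mul]
        ring
    _ ≤ _ := by gcongr

theorem sum_setIntegral_comp_affine_le_of_ratio {q : ℝ} (hq1 : 1 < q) (hq2 : q < 2) {φ : ℂ → ℝ}
    (hφ : ContDiff ℝ 1 φ) (hc : HasCompactSupport φ) {ι : Type*} (T : Finset ι) (x : ι → ℂ)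
    {c L m : ℝ} (hc0 : 0 < c) (hL : 0 < L) (hcm : c * L ≤ m) (hmL : m ≤ L) {b : ℂ} (hb : ‖b‖ ≤ L)
    (hsep : ∀ i ∈ T, ∀ j ∈ T, i ≠ j → 2 * L ≤ dist (x i) (x j)) {η : ℝ} (hη : 0 < η)
    (hη1 : η ≤ 1) :
    ∑ i ∈ T, ∫ u in ball (0 : ℂ) 1, φ (x i + b + m • u) ≤
      (∑ i ∈ T, ∫ u in ball (0 : ℂ) 1, φ (x i + L • u)) +
        (η * (T.card * volume.real (ball (0 : ℂ) 1)) +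
          4 / c ^ 2 * η⁻¹ * L ^ (q - 2) * ∫ z, ‖fderiv ℝ φ z‖ ^ q) := by
  have hcL : 0 < c * L := by positivity
  have hm : 0 < m := hcL.trans_le hcm
  refine (sum_setIntegral_comp_affine_le hq1 hφ hc T x hm hmL hb hsep
    (δ := η / (2 * L)) (by positivity)).trans ?_
  have hI : 0 ≤ ∫ z, ‖fderiv ℝ φ z‖ ^ q := integral_nonneg fun z => by positivity
  have key : 2 * L * ((η / (2 * L)) ^ (1 - q) * (m ^ 2)⁻¹) ≤
      4 / c ^ 2 * η⁻¹ * L ^ (q - 2) := by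
    have h1 : (m ^ 2)⁻¹ ≤ (c ^ 2)⁻¹ * (L ^ 2)⁻¹ := by
      rw [← mul_inv, ← mul_pow]; gcongr
    have h2 : (η / (2 * L)) ^ (1 - q) = η ^ (1 - q) * (2 * L) ^ (q - 1) := by
      rw [Real.div_rpow hη.le (by positivity), div_eq_mul_inv, ← Real.rpow_neg (by positivity),
        neg_sub]
    have h3 : η ^ (1 - q) ≤ η⁻¹ := by
      rw [← Real.rpow_neg_one]
      exact Real.rpow_le_rpow_of_exponent_ge hη hη1 (by linarith)
    have h4 : 2 * L * (2 * L) ^ (q - 1) = (2 * L) ^ q := by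
      rw [Real.rpow_sub_one (by positivity)]; field_simp
    have h5 : (2 * L) ^ q * (L ^ 2)⁻¹ ≤ 4 * L ^ (q - 2) := by
      rw [Real.mul_rpow (by norm_num) hL.le, Real.rpow_sub hL, Real.rpow_two, ← div_eq_mul_inv,
        mul_div_assoc]
      gcongr
      calc (2 : ℝ) ^ q ≤ 2 ^ (2 : ℝ) := Real.rpow_le_rpow_of_exponent_le (by norm_num) hq2.le
        _ = 4 := by norm_num
    calc 2 * L * ((η / (2 * L)) ^ (1 - q) * (m ^ 2)⁻¹)
        ≤ 2 * L * ((η⁻¹ * (2 * L) ^ (q - 1)) * ((c ^ 2)⁻¹ * (L ^ 2)⁻¹)) := by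
          rw [h2]; gcongr
      _ = η⁻¹ * (c ^ 2)⁻¹ * ((2 * L * (2 * L) ^ (q - 1)) * (L ^ 2)⁻¹) := by ring
      _ ≤ η⁻¹ * (c ^ 2)⁻¹ * (4 * L ^ (q - 2)) := by rw [h4]; gcongr
      _ = _ := by ring
  have h6 : 2 * L * (η / (2 * L) * (T.card * volume.real (ball (0 : ℂ) 1))) =
      η * (T.card * volume.real (ball (0 : ℂ) 1)) := by
    field_simp
  have h7 := mul_le_mul_of_nonneg_right key hI
  rw [mul_add, h6]
  linarith

theorem sum_range_inv_sq_le (N : ℕ) : ∑ n ∈ Finset.range N, ((n + 1 : ℝ) ^ 2)⁻¹ ≤ 2 := by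
  have h : ∀ N : ℕ, ∑ n ∈ Finset.range (N + 1), ((n + 1 : ℝ) ^ 2)⁻¹ ≤ 2 - (N + 1 : ℝ)⁻¹ := by
    intro N
    induction N with
    | zero => norm_num
    | succ N ih =>
      rw [Finset.sum_range_succ]
      have h1 : (((N + 1 : ℕ) + 1 : ℝ) ^ 2)⁻¹ ≤ (N + 1 : ℝ)⁻¹ - ((N + 1 : ℕ) + 1 : ℝ)⁻¹ := by
        push_cast
        rw [inv_sub_inv (by positivity) (by positivity), ← one_div, div_le_div_iff₀ (by positivity)
          (by positivity)]
        nlinarith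
      linarith
  rcases N with _ | N
  · simp
  · have : 0 < (N + 1 : ℝ)⁻¹ := by positivity
    linarith [h N]

theorem sub_le_sum_of_step {f e : ℕ → ℝ} (h : ∀ n, f (n + 1) ≤ f n + e n) (N : ℕ) :
    f N ≤ f 0 + ∑ n ∈ Finset.range N, e n := by
  induction N with
  | zero => simp
  | succ N ih => rw [Finset.sum_range_succ]; linarith [h N]

theorem tendsto_setIntegral_unitBall_comp_smul {φ : ℂ → ℝ} {R : ℕ → ℝ} (hR : Tendsto R atTop atTop)
    (hφ : Integrable φ) :
    Tendsto (fun n => ∫ u in ball (0 : ℂ) 1, φ (R n • u)) atTop (nhds 0) := by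
  have hlim : Tendsto (fun n => (R n ^ 2)⁻¹ * ∫ x, ‖φ x‖) atTop (nhds 0) := by
    have h1 := ((tendsto_pow_atTop two_ne_zero).comp hR).inv_tendsto_atTop
    simpa using h1.mul_const (∫ x, ‖φ x‖)
  refine squeeze_zero_norm' ?_ hlim
  filter_upwards [hR.eventually_gt_atTop 0] with n hn
  have h1 := setIntegral_unitBall_comp_affine φ 0 hn
  simp only [zero_add] at h1
  rw [h1, norm_mul, Real.norm_of_nonneg (by positivity)]
  gcongr
  exact (norm_integral_le_integral_norm _).trans
    (setIntegral_le_integral hφ.norm (ae_of_all _ fun _ => norm_nonneg _))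

/-- A quantitative Sobolev-type bound for the average of a function on a disc. -/
theorem exists_setIntegral_unitBall_le {q : ℝ} (hq1 : 1 < q) (hq2 : q < 2) {R : ℝ} (hR : 0 < R) :
    ∃ A : ℝ, ∀ φ : ℂ → ℝ, ContDiff ℝ 1 φ → HasCompactSupport φ →
      ∫ u in ball (0 : ℂ) 1, φ (R • u) ≤
        volume.real (ball (0 : ℂ) 1) / 4 + A * ∫ z, ‖fderiv ℝ φ z‖ ^ q := by
  set V := volume.real (ball (0 : ℂ) 1)
  set r : ℝ := 2 ^ (q - 2) with hr
  have hr0 : 0 < r := by positivity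
  have hr1 : r < 1 := Real.rpow_lt_one_of_one_lt_of_neg (by norm_num) (by linarith)
  set w : ℕ → ℝ := fun n => ((n + 1 : ℕ) : ℝ) ^ 2 * r ^ (n + 1) with hw
  have hws : Summable w := (summable_nat_add_iff 1).2
    (summable_pow_mul_geometric_of_norm_lt_one 2 (r := r) (by rwa [Real.norm_of_nonneg hr0.le]))
  refine ⟨128 * R ^ (q - 2) * ∑' n, w n, fun φ hφ hc => ?_⟩
  set I := ∫ z, ‖fderiv ℝ φ z‖ ^ q
  have hI : 0 ≤ I := integral_nonneg fun z => by positivity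
  set f : ℕ → ℝ := fun n => ∫ u in ball (0 : ℂ) 1, φ ((R * 2 ^ n) • u) with hf
  have hstep : ∀ n, -f (n + 1) ≤ -f n +
      (((n + 1 : ℝ) ^ 2)⁻¹ * (V / 8) + 128 * R ^ (q - 2) * I * w n) := by
    intro n
    have h1 : (1 : ℝ) ≤ (n + 1 : ℝ) ^ 2 := one_le_pow₀ (by linarith [n.cast_nonneg (α := ℝ)])
    have h := sum_setIntegral_comp_affine_le_of_ratio hq1 hq2 hφ hc ({0} : Finset ℕ)
      (fun _ => (0 : ℂ)) (c := 1 / 2) (L := R * 2 ^ (n + 1)) (m := R * 2 ^ n) (by norm_num)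
      (by positivity) (by rw [pow_succ]; linarith) (by gcongr <;> norm_num) (b := 0)
      (by simp; positivity) (by simp) (η := (8 * (n + 1 : ℝ) ^ 2)⁻¹) (by positivity)
      (inv_le_one_of_one_le₀ (by linarith))
    have h2 : (R * 2 ^ (n + 1)) ^ (q - 2) = R ^ (q - 2) * r ^ (n + 1) := by
      rw [Real.mul_rpow hR.le (by positivity), hr, ← Real.rpow_natCast, ← Real.rpow_natCast,
        ← Real.rpow_mul (by norm_num), ← Real.rpow_mul (by norm_num), mul_comm (q - 2)]
    rw [h2] at h
    simp only [Finset.sum_singleton, zero_add, add_zero, Finset.card_singleton, inv_inv, mul_inv]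
      at h
    simp only [hf, hw]
    push_cast at h ⊢
    linarith
  have hsum : ∀ N, f 0 ≤ f N + (V / 4 + 128 * R ^ (q - 2) * (∑' n, w n) * I) := by
    intro N
    have h1 := sub_le_sum_of_step (f := fun n => - f n) hstep N
    rw [Finset.sum_add_distrib, ← Finset.sum_mul, ← Finset.mul_sum] at h1
    have h2 : ∑ n ∈ Finset.range N, w n ≤ ∑' n, w n :=
      hws.sum_le_tsum _ fun n _ => by positivity
    have h3 := mul_le_mul_of_nonneg_right (sum_range_inv_sq_le N)
      (by positivity : 0 ≤ V / 8)
    have h4 := mul_le_mul_of_nonneg_left h2 (by positivity : 0 ≤ 128 * R ^ (q - 2) * I)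
    linarith
  have hlim : Tendsto f atTop (nhds 0) := by
    refine tendsto_setIntegral_unitBall_comp_smul ?_
      (hφ.continuous.integrable_of_hasCompactSupport hc)
    exact (tendsto_pow_atTop_atTop_of_one_lt (by norm_num : (1 : ℝ) < 2)).const_mul_atTop hR
  have := ge_of_tendsto' (hlim.add_const (V / 4 + 128 * R ^ (q - 2) * (∑' n, w n) * I)) hsum
  simpa [hf] using this

theorem sum_erase_add_ite (s : ℕ → ℝ) (S : Finset ℕ) (n : ℕ) :
    ∑ k ∈ S, s k = ∑ k ∈ S.erase n, s k + if n ∈ S then s n else 0 := by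
  split_ifs with h
  · rw [Finset.sum_erase_add _ _ h]
  · rw [Finset.erase_eq_of_notMem h, add_zero]

theorem le_abs_sum_sub_sum {s : ℕ → ℝ} (hs0 : ∀ n, 0 < s n) (hs : ∀ n, 2 * s (n + 1) ≤ s n)
    (n : ℕ) {S T : Finset ℕ} (hS : S ⊆ Finset.range (n + 1)) (hT : T ⊆ Finset.range (n + 1))
    (hST : S ≠ T) : s n ≤ |∑ k ∈ S, s k - ∑ k ∈ T, s k| := by
  have herase : ∀ {m : ℕ} {S : Finset ℕ}, S ⊆ Finset.range (m + 1) →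
      S.erase m ⊆ Finset.range m := by
    intro m S hS k hk
    have := hS (Finset.mem_of_mem_erase hk)
    have := Finset.ne_of_mem_erase hk
    simp only [Finset.mem_range] at *
    omega
  have hne : ∀ {m : ℕ} {S T : Finset ℕ}, S ≠ T → S.erase m = T.erase m →
      s m ≤ |∑ k ∈ S, s k - ∑ k ∈ T, s k| := by
    intro m S T hST h
    rw [sum_erase_add_ite s S m, sum_erase_add_ite s T m, h]
    by_cases h1 : m ∈ S <;> by_cases h2 : m ∈ T
    · exact absurd (by rw [← Finset.insert_erase h1, h, Finset.insert_erase h2]) hST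
    · simp [h1, h2, le_abs_self]
    · simp [h1, h2, le_abs_self]
    · exact absurd (by
        rw [← Finset.erase_eq_of_notMem h1, h, Finset.erase_eq_of_notMem h2]) hST
  induction n generalizing S T with
  | zero =>
    refine hne hST ?_
    rw [Finset.subset_empty.1 (herase hS), Finset.subset_empty.1 (herase hT)]
  | succ n ih =>
    by_cases h : S.erase (n + 1) = T.erase (n + 1)
    · exact hne hST h
    · have h1 := ih (herase hS) (herase hT) h
      rw [sum_erase_add_ite s S (n + 1), sum_erase_add_ite s T (n + 1)]
      set a := ∑ k ∈ S.erase (n + 1), s k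
      set b := ∑ k ∈ T.erase (n + 1), s k
      have h2 := hs n
      have h3 := hs0 (n + 1)
      have h4 : |a - b| ≤ |(a + if n + 1 ∈ S then s (n + 1) else 0) -
          (b + if n + 1 ∈ T then s (n + 1) else 0)| + s (n + 1) := by
        have h5 : |(if n + 1 ∈ T then s (n + 1) else 0) - (if n + 1 ∈ S then s (n + 1) else 0)|
            ≤ s (n + 1) := by
          split_ifs <;> simp [abs_of_pos h3, h3.le]
        refine le_trans ?_ (add_le_add_right h5 _)
        refine le_trans (le_of_eq ?_) (abs_add_le _ _)
        congr 1
        ring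
      linarith

theorem two_mul_le_abs_sum_sub_sum {s : ℕ → ℝ} (hs0 : ∀ n, 0 < s n)
    (hs : ∀ n, 2 * s (n + 1) ≤ s n) (n : ℕ) {S T : Finset ℕ} (hS : S ⊆ Finset.range n)
    (hT : T ⊆ Finset.range n) (hST : S ≠ T) : 2 * s n ≤ |∑ k ∈ S, s k - ∑ k ∈ T, s k| := by
  rcases n with _ | n
  · exact absurd ((Finset.subset_empty.1 hS).trans (Finset.subset_empty.1 hT).symm) hST
  · exact (hs n).trans (le_abs_sum_sub_sum hs0 hs n hS hT hST)

theorem dist_ofReal_ofReal (a b : ℝ) : dist (a : ℂ) (b : ℂ) = |a - b| := by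
  rw [Complex.dist_eq, ← Complex.ofReal_sub, Complex.norm_real, Real.norm_eq_abs]

theorem cantor_step {q : ℝ} (hq1 : 1 < q) (hq2 : q < 2) {s : ℕ → ℝ} (hs0 : ∀ n, 0 < s n)
    (hs : ∀ n, 2 * s (n + 1) ≤ s n) {c : ℝ} (hc0 : 0 < c) (hcs : ∀ n, c * s n ≤ s (n + 1))
    {φ : ℂ → ℝ} (hφ : ContDiff ℝ 1 φ) (hc : HasCompactSupport φ) (n : ℕ) {η : ℝ} (hη : 0 < η)
    (hη1 : η ≤ 1) :
    (2 ^ (n + 1))⁻¹ * ∑ S ∈ (Finset.range (n + 1)).powerset, ∫ u in ball (0 : ℂ) 1,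
        φ (((∑ k ∈ S, s k : ℝ) : ℂ) + s (n + 1) • u) ≤
      (2 ^ n)⁻¹ * (∑ S ∈ (Finset.range n).powerset, ∫ u in ball (0 : ℂ) 1,
        φ (((∑ k ∈ S, s k : ℝ) : ℂ) + s n • u)) + (η * volume.real (ball (0 : ℂ) 1) +
        4 / c ^ 2 * η⁻¹ * (s n ^ (q - 2) * (2 ^ n)⁻¹) * ∫ z, ‖fderiv ℝ φ z‖ ^ q) := by
  have h := fun (b : ℂ) (hb : ‖b‖ ≤ s n) =>
    sum_setIntegral_comp_affine_le_of_ratio hq1 hq2 hφ hc (Finset.range n).powerset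
      (fun S => ((∑ k ∈ S, s k : ℝ) : ℂ)) hc0 (hs0 n) (hcs n) (by linarith [hs n, hs0 (n + 1)])
      hb (fun S hS T hT hST => by
        rw [dist_ofReal_ofReal]
        exact two_mul_le_abs_sum_sub_sum hs0 hs n (Finset.mem_powerset.1 hS)
          (Finset.mem_powerset.1 hT) hST) hη hη1
  have h0 := h 0 (by simpa using (hs0 n).le)
  have h1 := h (s n : ℂ) (by simp [abs_of_pos (hs0 n)])
  rw [Finset.range_add_one, Finset.sum_powerset_insert Finset.notMem_range_self]
  have h2 : ∀ S ∈ (Finset.range n).powerset, ∫ u in ball (0 : ℂ) 1,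
      φ (((∑ k ∈ insert n S, s k : ℝ) : ℂ) + s (n + 1) • u) = ∫ u in ball (0 : ℂ) 1,
      φ (((∑ k ∈ S, s k : ℝ) : ℂ) + s n + s (n + 1) • u) := by
    intro S hS
    have hn : n ∉ S := fun hn => Finset.notMem_range_self (Finset.mem_powerset.1 hS hn)
    rw [Finset.sum_insert hn, add_comm (s n), Complex.ofReal_add]
  rw [Finset.sum_congr rfl h2]
  simp only [add_zero, Finset.card_powerset, Finset.card_range, Nat.cast_pow, Nat.cast_ofNat]
    at h0 h1
  have h3 := mul_le_mul_of_nonneg_left (add_le_add h0 h1)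
    (by positivity : (0 : ℝ) ≤ (2 ^ (n + 1))⁻¹)
  refine h3.trans (le_of_eq ?_)
  rw [pow_succ]
  field_simp
  ring

theorem exists_le_integral_norm_fderiv_rpow {q : ℝ} (hq1 : 1 < q) (hq2 : q < 2) {s : ℕ → ℝ}
    (hs0 : ∀ n, 0 < s n) (hs : ∀ n, 2 * s (n + 1) ≤ s n) (hlim : Tendsto s atTop (nhds 0))
    {c : ℝ} (hc0 : 0 < c) (hcs : ∀ n, c * s n ≤ s (n + 1))
    (hsq : ∀ n : ℕ, s n ^ (q - 2) * (2 ^ n)⁻¹ ≤ ((n + 1 : ℝ) ^ 4)⁻¹) :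
    ∃ ε : ℝ, 0 < ε ∧ ∀ φ : ℂ → ℝ, ContDiff ℝ 1 φ → HasCompactSupport φ →
      (∀ S : Finset ℕ, 1 ≤ φ ((∑ k ∈ S, s k : ℝ) : ℂ)) → ε ≤ ∫ z, ‖fderiv ℝ φ z‖ ^ q := by
  obtain ⟨A, hA⟩ := exists_setIntegral_unitBall_le hq1 hq2 (hs0 0)
  set V := volume.real (ball (0 : ℂ) 1)
  have hV : 0 < V := ENNReal.toReal_pos (measure_ball_pos _ _ one_pos).ne' measure_ball_lt_top.ne
  suffices h : ∀ φ : ℂ → ℝ, ContDiff ℝ 1 φ → HasCompactSupport φ →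
      (∀ S : Finset ℕ, 1 ≤ φ ((∑ k ∈ S, s k : ℝ) : ℂ)) →
      V ≤ V / 2 + (A + 64 / c ^ 2) * ∫ z, ‖fderiv ℝ φ z‖ ^ q by
    refine ⟨V / 2 / (|A| + 64 / c ^ 2), by positivity, fun φ hφ hc hS => ?_⟩
    rw [div_le_iff₀ (by positivity)]
    have hI : 0 ≤ ∫ z, ‖fderiv ℝ φ z‖ ^ q := integral_nonneg fun z => by positivity
    nlinarith [h φ hφ hc hS, mul_le_mul_of_nonneg_right (le_abs_self A) hI]
  intro φ hφ hc hS
  set I := ∫ z, ‖fderiv ℝ φ z‖ ^ q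
  have hI : 0 ≤ I := integral_nonneg fun z => by positivity
  obtain ⟨K, hK⟩ := hφ.lipschitzWith_of_hasCompactSupport hc one_ne_zero
  set f : ℕ → ℝ := fun n => (2 ^ n)⁻¹ * ∑ S ∈ (Finset.range n).powerset,
    ∫ u in ball (0 : ℂ) 1, φ (((∑ k ∈ S, s k : ℝ) : ℂ) + s n • u) with hf
  have hstep : ∀ n, f (n + 1) ≤ f n + ((n + 1 : ℝ) ^ 2)⁻¹ * (V / 8 + 32 / c ^ 2 * I) := by
    intro n
    have h1 : (1 : ℝ) ≤ (n + 1 : ℝ) ^ 2 := one_le_pow₀ (by linarith [n.cast_nonneg (α := ℝ)])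
    refine (cantor_step hq1 hq2 hs0 hs hc0 hcs hφ hc n (η := (8 * (n + 1 : ℝ) ^ 2)⁻¹)
      (by positivity) (inv_le_one_of_one_le₀ (by linarith))).trans ?_
    have h2 : 4 / c ^ 2 * ((8 * (n + 1 : ℝ) ^ 2)⁻¹)⁻¹ * (s n ^ (q - 2) * (2 ^ n)⁻¹) * I ≤
        4 / c ^ 2 * ((8 * (n + 1 : ℝ) ^ 2)⁻¹)⁻¹ * ((n + 1 : ℝ) ^ 4)⁻¹ * I := by
      gcongr
      exact hsq n
    have h3 : 4 / c ^ 2 * ((8 * (n + 1 : ℝ) ^ 2)⁻¹)⁻¹ * ((n + 1 : ℝ) ^ 4)⁻¹ * I =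
        ((n + 1 : ℝ) ^ 2)⁻¹ * (32 / c ^ 2 * I) := by
      field_simp
      ring
    have h4 : (8 * (n + 1 : ℝ) ^ 2)⁻¹ * V = ((n + 1 : ℝ) ^ 2)⁻¹ * (V / 8) := by
      rw [mul_inv]; ring
    simp only [hf]
    linarith
  have hupper : ∀ N, f N ≤ V / 2 + (A + 64 / c ^ 2) * I := by
    intro N
    have h1 := sub_le_sum_of_step hstep N
    rw [← Finset.sum_mul] at h1
    have h2 := mul_le_mul_of_nonneg_right (sum_range_inv_sq_le N)
      (by positivity : 0 ≤ V / 8 + 32 / c ^ 2 * I)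
    have h3 : f 0 ≤ V / 4 + A * I := by simpa [hf] using hA φ hφ hc
    have h4 : 2 * (32 / c ^ 2 * I) = 64 / c ^ 2 * I := by ring
    linarith
  have hlower : ∀ N, V * (1 - K * s N) ≤ f N := by
    intro N
    have h1 : ∀ S ∈ (Finset.range N).powerset, V * (1 - K * s N) ≤
        ∫ u in ball (0 : ℂ) 1, φ (((∑ k ∈ S, s k : ℝ) : ℂ) + s N • u) := by
      intro S _
      have hφc := hφ.continuous
      calc V * (1 - K * s N) = ∫ u in ball (0 : ℂ) 1, (1 - K * s N) := by
            simp [V, mul_comm]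
        _ ≤ _ := by
          refine setIntegral_mono_on (integrableOn_const measure_ball_lt_top.ne) ?_
            measurableSet_ball fun u hu => ?_
          · refine IntegrableOn.mono_set (t := closedBall (0 : ℂ) 1) ?_ ball_subset_closedBall
            exact (by fun_prop : Continuous fun u : ℂ =>
              φ (((∑ k ∈ S, s k : ℝ) : ℂ) + s N • u)).continuousOn.integrableOn_compact
              (isCompact_closedBall _ _)
          · have h2 := hK.dist_le_mul (((∑ k ∈ S, s k : ℝ) : ℂ) + s N • u)
              ((∑ k ∈ S, s k : ℝ) : ℂ)
            rw [dist_self_add_left, norm_smul, Real.norm_of_nonneg (hs0 N).le, Real.dist_eq] at h2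
            have h3 : ‖u‖ ≤ 1 := (mem_ball_zero_iff.1 hu).le
            have h4 : (K : ℝ) * (s N * ‖u‖) ≤ K * (s N * 1) := by
              have := (hs0 N).le
              gcongr
            linarith [hS S, (abs_le.1 h2).1]
    have h2 := Finset.card_nsmul_le_sum _ _ _ h1
    simp only [Finset.card_powerset, Finset.card_range, nsmul_eq_mul, Nat.cast_pow,
      Nat.cast_ofNat] at h2
    simp only [hf]
    rw [inv_mul_eq_div, le_div_iff₀ (by positivity)]
    linarith
  refine le_of_tendsto' (f := fun N => V * (1 - K * s N)) (x := atTop) ?_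
    fun N => (hlower N).trans (hupper N)
  simpa using ((hlim.const_mul (K : ℝ)).const_sub 1).const_mul V

/-- The real number with digits `ω` with respect to the digit sizes `s`. -/
def digitSum (s : ℕ → ℝ) (ω : ℕ → Bool) : ℝ := ∑' k, if ω k then s k else 0

/-- The Cantor set of all digit sums with digit sizes `s`, as a subset of the real axis. -/
def cantorDigitSet (s : ℕ → ℝ) : Set ℂ := Set.range fun ω => (digitSum s ω : ℂ)

theorem summable_digits {s : ℕ → ℝ} (hs0 : ∀ n, 0 < s n) (hsum : Summable s) (ω : ℕ → Bool) :
    Summable fun k => if ω k then s k else 0 := by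
  refine hsum.of_nonneg_of_le (fun k => ?_) fun k => ?_ <;> split_ifs <;> simp [(hs0 k).le]

theorem isCompact_cantorDigitSet {s : ℕ → ℝ} (hs0 : ∀ n, 0 < s n) (hsum : Summable s) :
    IsCompact (cantorDigitSet s) := by
  refine isCompact_range (Complex.continuous_ofReal.comp ?_)
  refine continuous_tsum (fun k => ?_) hsum fun k ω => ?_
  · exact (continuous_of_discreteTopology (f := fun b : Bool => if b then s k else 0)).comp
      (continuous_apply k)
  · split_ifs <;> simp [abs_of_pos (hs0 k), (hs0 k).le]

theorem sum_mem_cantorDigitSet (s : ℕ → ℝ) (S : Finset ℕ) :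
    ((∑ k ∈ S, s k : ℝ) : ℂ) ∈ cantorDigitSet s := by
  refine ⟨fun k => decide (k ∈ S), ?_⟩
  simp only [digitSum]
  rw [tsum_eq_sum (s := S) fun k hk => by simp [hk]]
  congr 1
  exact Finset.sum_congr rfl fun k hk => by simp [hk]

theorem cantorDigitSet_uniformlyPerfect {s : ℕ → ℝ} (hs0 : ∀ n, 0 < s n) (hsum : Summable s)
    {c : ℝ} (hc0 : 0 < c) (hcs : ∀ n, c * s n ≤ s (n + 1)) {a : ℂ} (ha : a ∈ cantorDigitSet s)
    {r : ℝ} (hr : 0 < r) (hr0 : r < s 0) :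
    (cantorDigitSet s ∩ {z : ℂ | c * r ≤ dist z a ∧ dist z a ≤ r}).Nonempty := by
  obtain ⟨ω, rfl⟩ := ha
  have hex : ∃ n, s n ≤ r :=
    ((hsum.tendsto_atTop_zero.eventually (gt_mem_nhds hr)).exists).imp fun _ h => le_of_lt h
  classical
  obtain ⟨n, hn, hmin⟩ : ∃ n, s (n + 1) ≤ r ∧ r < s n := by
    have h1 := Nat.find_spec hex
    have h2 := fun m => Nat.find_min hex (m := m)
    generalize Nat.find hex = k at h1 h2
    rcases k with _ | k
    · linarith
    · exact ⟨k, h1, not_le.1 (h2 k k.lt_succ_self)⟩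
  set ω' := Function.update ω (n + 1) (!ω (n + 1)) with hω'
  have hdist : dist (digitSum s ω' : ℂ) (digitSum s ω : ℂ) = s (n + 1) := by
    rw [dist_ofReal_ofReal, digitSum, digitSum,
      ← (summable_digits hs0 hsum ω').tsum_sub (summable_digits hs0 hsum ω),
      tsum_eq_single (n + 1) fun k hk => by simp [hω', Function.update_of_ne hk]]
    cases h : ω (n + 1) <;> simp [hω', h, abs_of_pos (hs0 (n + 1))]
  refine ⟨digitSum s ω', ⟨ω', rfl⟩, ?_, ?_⟩
  · simp only [hdist]
    exact (mul_le_mul_of_nonneg_left hmin.le hc0.le).trans (hcs n)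
  · simpa only [hdist] using hn

theorem le_mul_pow_of_ratio {s : ℕ → ℝ} {ρ : ℝ} (hρ : 0 ≤ ρ) (hs : ∀ n, s (n + 1) ≤ ρ * s n)
    (n k : ℕ) : s (n + k) ≤ s n * ρ ^ k := by
  induction k with
  | zero => simp
  | succ k ih =>
    calc s (n + (k + 1)) ≤ ρ * s (n + k) := hs (n + k)
      _ ≤ ρ * (s n * ρ ^ k) := by gcongr
      _ = _ := by ring

theorem summable_of_ratio {s : ℕ → ℝ} (hs0 : ∀ n, 0 < s n) {ρ : ℝ} (hρ : 0 < ρ) (hρ1 : ρ < 1)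
    (hs : ∀ n, s (n + 1) ≤ ρ * s n) : Summable s := by
  refine ((summable_geometric_of_lt_one hρ.le hρ1).mul_left (s 0)).of_nonneg_of_le
    (fun n => (hs0 n).le) fun n => ?_
  simpa using le_mul_pow_of_ratio hρ.le hs 0 n

theorem abs_digitSum_sub_le {s : ℕ → ℝ} (hs0 : ∀ n, 0 < s n) {ρ : ℝ} (hρ : 0 < ρ) (hρ1 : ρ < 1)
    (hs : ∀ n, s (n + 1) ≤ ρ * s n) (ω : ℕ → Bool) (n : ℕ) :
    |digitSum s ω - (∑ k ∈ (Finset.range (n + 1)).filter fun k => ω k, s k) -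
      ρ / (2 * (1 - ρ)) * s n| ≤ ρ / (2 * (1 - ρ)) * s n := by
  have hsum := summable_of_ratio hs0 hρ hρ1 hs
  have hd := summable_digits hs0 hsum ω
  have h1 := hd.sum_add_tsum_nat_add (n + 1)
  rw [Finset.sum_filter, digitSum, ← h1, add_sub_cancel_left]
  have h2 : 0 ≤ ∑' i, (if ω (i + (n + 1)) then s (i + (n + 1)) else 0) :=
    tsum_nonneg fun i => by split_ifs <;> simp [(hs0 _).le]
  have h3 : ∑' i, (if ω (i + (n + 1)) then s (i + (n + 1)) else 0) ≤
      ∑' i, s n * ρ * ρ ^ i := by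
    refine ((summable_nat_add_iff (n + 1)).2 hd).tsum_le_tsum (fun i => ?_)
      ((summable_geometric_of_lt_one hρ.le hρ1).mul_left _)
    have := le_mul_pow_of_ratio hρ.le hs n (i + 1)
    rw [show n + (i + 1) = i + (n + 1) by ring, pow_succ'] at this
    have := hs0 n
    split_ifs
    · linarith
    · positivity
  rw [tsum_mul_left, tsum_geometric_of_lt_one hρ.le hρ1] at h3
  have h4 : s n * ρ * (1 - ρ)⁻¹ = 2 * (ρ / (2 * (1 - ρ)) * s n) := by
    have : 1 - ρ ≠ 0 := by linarith
    field_simp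
  rw [abs_le]
  constructor <;> linarith

theorem norm_sum_rpow_le_of_disjoint {ι F : Type*} [NormedAddCommGroup F] {p : ℝ} (hp : 0 < p)
    (T : Finset ι) (v : ι → F) (h : ∀ i ∈ T, ∀ j ∈ T, i ≠ j → v i = 0 ∨ v j = 0) :
    ‖∑ i ∈ T, v i‖ ^ p ≤ ∑ i ∈ T, ‖v i‖ ^ p := by
  by_cases hT : ∃ i ∈ T, v i ≠ 0
  · obtain ⟨i, hi, hvi⟩ := hT
    rw [Finset.sum_eq_single_of_mem i hi fun j hj hji => (h j hj i hi hji).resolve_right hvi]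
    exact Finset.single_le_sum (f := fun i => ‖v i‖ ^ p) (fun j _ => by positivity) hi
  · push Not at hT
    rw [Finset.sum_eq_zero hT, norm_zero, Real.zero_rpow hp.ne']
    exact Finset.sum_nonneg fun j _ => by positivity

theorem fderiv_comp_inv_smul_sub {ψ : ℂ → ℝ} (hψ : Differentiable ℝ ψ) (L : ℝ) (a z : ℂ) :
    fderiv ℝ (fun z => ψ (L⁻¹ • (z - a))) z = L⁻¹ • fderiv ℝ ψ (L⁻¹ • (z - a)) := by
  have h1 : HasFDerivAt (fun z : ℂ => L⁻¹ • (z - a)) (L⁻¹ • ContinuousLinearMap.id ℝ ℂ) z :=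
    ((hasFDerivAt_id z).sub_const a).const_smul L⁻¹
  have h2 := (hψ (L⁻¹ • (z - a))).hasFDerivAt.comp z h1
  rw [show (fun z => ψ (L⁻¹ • (z - a))) = ψ ∘ fun z => L⁻¹ • (z - a) from rfl, h2.fderiv]
  ext v
  simp

theorem integral_norm_fderiv_comp_inv_smul_sub {ψ : ℂ → ℝ} (hψ : Differentiable ℝ ψ) {L : ℝ}
    (hL : 0 < L) (a : ℂ) (p : ℝ) :
    ∫ z, ‖fderiv ℝ (fun z => ψ (L⁻¹ • (z - a))) z‖ ^ p =
      L ^ (2 - p) * ∫ z, ‖fderiv ℝ ψ z‖ ^ p := by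
  simp_rw [fderiv_comp_inv_smul_sub hψ, norm_smul, Real.norm_of_nonneg (inv_nonneg.2 hL.le),
    Real.mul_rpow (inv_nonneg.2 hL.le) (norm_nonneg _)]
  rw [integral_const_mul, integral_sub_right_eq_self (fun z => ‖fderiv ℝ ψ (L⁻¹ • z)‖ ^ p) a,
    Measure.integral_comp_inv_smul_of_nonneg volume (fun z => ‖fderiv ℝ ψ z‖ ^ p) hL.le,
    Complex.finrank_real_complex, smul_eq_mul, Real.rpow_sub hL, Real.inv_rpow hL.le,
    Real.rpow_two]
  ring

theorem capacity_nonneg (p : ℝ) (E : Set ℂ) : 0 ≤ capacity p E := by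
  refine Real.sInf_nonneg ?_
  rintro _ ⟨φ, -, -, -, rfl⟩
  exact integral_nonneg fun z => by positivity

theorem capacity_le {p : ℝ} {E : Set ℂ} {φ : ℂ → ℝ} (hφ : ContDiff ℝ (⊤ : ℕ∞) φ)
    (hc : HasCompactSupport φ) (hE : ∀ x ∈ E, 1 ≤ φ x) :
    capacity p E ≤ ∫ x : ℂ, ‖fderiv ℝ φ x‖ ^ p := by
  refine csInf_le ⟨0, ?_⟩ ⟨φ, hφ, hc, hE, rfl⟩
  rintro _ ⟨φ, -, -, -, rfl⟩
  exact integral_nonneg fun z => by positivity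

theorem le_capacity {p ε : ℝ} {E : Set ℂ} (hE : IsCompact E)
    (h : ∀ φ : ℂ → ℝ, ContDiff ℝ (⊤ : ℕ∞) φ → HasCompactSupport φ → (∀ x ∈ E, 1 ≤ φ x) →
      ε ≤ ∫ x : ℂ, ‖fderiv ℝ φ x‖ ^ p) : ε ≤ capacity p E := by
  refine le_csInf ?_ ?_
  · obtain ⟨R, hR0, hR⟩ := hE.isBounded.subset_closedBall_lt 0 (0 : ℂ)
    let f : ContDiffBump (0 : ℂ) := ⟨R, R + 1, hR0, by linarith⟩
    exact ⟨_, f, f.contDiff, f.hasCompactSupport,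
      fun x hx => (f.one_of_mem_closedBall (hR hx)).ge, rfl⟩
  · rintro _ ⟨φ, hφ, hc, hE', rfl⟩
    exact h φ hφ hc hE'

theorem exists_capacity_cantorDigitSet_le {s : ℕ → ℝ} (hs0 : ∀ n, 0 < s n) {ρ : ℝ} (hρ : 0 < ρ)
    (hρ1 : ρ < 1 / 2) (hs : ∀ n, s (n + 1) ≤ ρ * s n) {p : ℝ} (hp : 0 < p) :
    ∃ A : ℝ, ∀ n, capacity p (cantorDigitSet s) ≤ A * (2 ^ n * s n ^ (2 - p)) := by
  set τ := ρ / (2 * (1 - ρ)) with hτ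
  have hρ' : 0 < 1 - ρ := by linarith
  have hτ0 : 0 < τ := by positivity
  have hτ1 : τ < 1 / 2 := by
    rw [hτ, div_lt_iff₀ (by positivity)]; linarith
  have hs2 : ∀ n, 2 * s (n + 1) ≤ s n := fun n => by nlinarith [hs n, hs0 n]
  let ψ : ContDiffBump (0 : ℂ) := ⟨τ, (τ + 1 / 2) / 2, hτ0, by linarith⟩
  have hψd : ContDiff ℝ (⊤ : ℕ∞) ψ := ψ.contDiff
  refine ⟨2 * ∫ z, ‖fderiv ℝ ψ z‖ ^ p, fun n => ?_⟩
  set L := s n with hL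
  have hL0 : 0 < L := hs0 n
  set a : Finset ℕ → ℂ := fun S => ((∑ k ∈ S, s k + τ * L : ℝ) : ℂ) with ha
  set T := (Finset.range (n + 1)).powerset with hT
  set f : Finset ℕ → ℂ → ℝ := fun S z => ψ (L⁻¹ • (z - a S)) with hf
  have hfd : ∀ S, ContDiff ℝ (⊤ : ℕ∞) (f S) := fun S => hψd.comp (by fun_prop)
  have hfz : ∀ S z, L / 2 ≤ dist z (a S) → fderiv ℝ (f S) z = 0 := by
    intro S z hz
    rw [hf, fderiv_comp_inv_smul_sub (hψd.differentiable (by simp))]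
    have : fderiv ℝ ψ (L⁻¹ • (z - a S)) = 0 := by
      refine image_eq_zero_of_notMem_tsupport fun h => ?_
      have h1 := tsupport_fderiv_subset ℝ h
      rw [ψ.tsupport_eq, mem_closedBall_zero_iff, norm_smul, ← dist_eq_norm,
        Real.norm_of_nonneg (by positivity), inv_mul_le_iff₀ hL0] at h1
      simp only [ψ] at h1
      nlinarith
    rw [this, smul_zero]
  have hfc : ∀ S, HasCompactSupport (f S) := by
    intro S
    refine HasCompactSupport.intro (isCompact_closedBall (a S) (L / 2)) fun z hz => ?_
    refine ψ.zero_of_le_dist ?_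
    rw [mem_closedBall, not_le] at hz
    rw [dist_zero_right, norm_smul, ← dist_eq_norm, Real.norm_of_nonneg (by positivity),
      le_inv_mul_iff₀ hL0]
    simp only [ψ]
    nlinarith
  have hsep : ∀ z, ∀ S ∈ T, ∀ S' ∈ T, S ≠ S' →
      fderiv ℝ (f S) z = 0 ∨ fderiv ℝ (f S') z = 0 := by
    intro z S hS S' hS' hne
    by_contra! h
    have h1 : dist z (a S) < L / 2 := not_le.1 fun h' => h.1 (hfz S z h')
    have h2 : dist z (a S') < L / 2 := not_le.1 fun h' => h.2 (hfz S' z h')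
    have h3 := le_abs_sum_sub_sum hs0 hs2 n (Finset.mem_powerset.1 hS) (Finset.mem_powerset.1 hS')
      hne
    have h4 : dist (a S) (a S') = |∑ k ∈ S, s k - ∑ k ∈ S', s k| := by
      rw [ha, dist_ofReal_ofReal, add_sub_add_right_eq_sub]
    linarith [dist_triangle_left (a S) (a S') z]
  have hf_int : ∀ S ∈ T, Integrable fun z => ‖fderiv ℝ (f S) z‖ ^ p := fun S _ =>
    integrable_norm_fderiv_rpow hp ((hfd S).of_le (by simp)) (hfc S)
  have hsumd : ContDiff ℝ (⊤ : ℕ∞) fun z => ∑ S ∈ T, f S z := ContDiff.sum fun S _ => hfd S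
  have hsumc : HasCompactSupport fun z => ∑ S ∈ T, f S z := by
    refine HasCompactSupport.intro (K := ⋃ S ∈ T, tsupport (f S))
      (T.isCompact_biUnion fun S _ => hfc S) fun z hz => ?_
    simp only [Set.mem_iUnion, not_exists] at hz
    exact Finset.sum_eq_zero fun S hS => image_eq_zero_of_notMem_tsupport (hz S hS)
  have hone : ∀ x ∈ cantorDigitSet s, 1 ≤ ∑ S ∈ T, f S x := by
    rintro _ ⟨ω, rfl⟩
    set S := (Finset.range (n + 1)).filter fun k => ω k with hS
    have hST : S ∈ T := Finset.mem_powerset.2 (Finset.filter_subset _ _)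
    refine le_trans (le_of_eq ?_)
      (Finset.single_le_sum (f := fun S => f S (digitSum s ω)) (fun _ _ => ψ.nonneg) hST)
    refine (ψ.one_of_mem_closedBall ?_).symm
    rw [mem_closedBall_zero_iff, norm_smul, ← dist_eq_norm, Real.norm_of_nonneg (by positivity),
      inv_mul_le_iff₀ hL0, dist_ofReal_ofReal, ← sub_sub]
    have := abs_digitSum_sub_le hs0 hρ (by linarith) hs ω n
    simp only [ψ]
    linarith
  calc capacity p (cantorDigitSet s) ≤ ∫ z, ‖fderiv ℝ (fun z => ∑ S ∈ T, f S z) z‖ ^ p :=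
        capacity_le hsumd hsumc hone
    _ ≤ ∫ z, ∑ S ∈ T, ‖fderiv ℝ (f S) z‖ ^ p := by
        refine integral_mono (integrable_norm_fderiv_rpow hp (hsumd.of_le (by simp)) hsumc)
          (integrable_finsetSum _ hf_int) fun z => ?_
        simp only
        rw [fderiv_fun_sum fun S _ => (hfd S).differentiable (by simp) z]
        exact norm_sum_rpow_le_of_disjoint hp T _ (hsep z)
    _ = ∑ S ∈ T, L ^ (2 - p) * ∫ z, ‖fderiv ℝ ψ z‖ ^ p := by
        rw [integral_finsetSum _ hf_int]
        exact Finset.sum_congr rfl fun S _ =>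
          integral_norm_fderiv_comp_inv_smul_sub (hψd.differentiable (by simp)) hL0 _ _
    _ = _ := by
        rw [Finset.sum_const, hT, Finset.card_powerset, Finset.card_range, nsmul_eq_mul, pow_succ]
        push_cast
        ring

theorem exists_digit_sizes {d : ℝ} (hd0 : 0 < d) (hd1 : d < 1) :
    ∃ (s : ℕ → ℝ) (ρ c K : ℝ), (∀ n, 0 < s n) ∧ 0 < ρ ∧ ρ < 1 / 2 ∧ 0 < c ∧ 1 ≤ K ∧
      (∀ n, s (n + 1) ≤ ρ * s n) ∧ (∀ n, c * s n ≤ s (n + 1)) ∧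
      ∀ n : ℕ, 2 ^ n * s n ^ d = (n + K) ^ 4 := by
  have hlim : Tendsto (fun K : ℝ => (1 + K⁻¹) ^ 4 / 2) atTop (nhds (1 / 2)) := by
    simpa using ((tendsto_inv_atTop_zero (𝕜 := ℝ)).const_add 1).pow 4 |>.div_const 2
  have hhalf : (1 / 2 : ℝ) < (1 / 2) ^ d := by
    simpa using Real.rpow_lt_rpow_of_exponent_gt (x := 1 / 2) (by norm_num) (by norm_num) hd1
  obtain ⟨K, hK, hK1⟩ := ((hlim.eventually_lt_const hhalf).and (eventually_ge_atTop 1)).exists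
  have hK0 : 0 < K := by linarith
  refine ⟨fun n => ((n + K) ^ 4 / 2 ^ n) ^ (1 / d), ((1 + K⁻¹) ^ 4 / 2) ^ (1 / d),
    (1 / 2) ^ (1 / d), K, fun n => by positivity, by positivity, ?_, by positivity, hK1,
    fun n => ?_, fun n => ?_, fun n => ?_⟩
  · have h1 : ((1 + K⁻¹) ^ 4 / 2) ^ (1 / d) < ((1 / 2 : ℝ) ^ d) ^ (1 / d) :=
      Real.rpow_lt_rpow (by positivity) hK (by positivity)
    rwa [← Real.rpow_mul (by norm_num), mul_one_div_cancel hd0.ne', Real.rpow_one] at h1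
  · rw [← Real.mul_rpow (by positivity) (by positivity)]
    refine Real.rpow_le_rpow (by positivity) ?_ (by positivity)
    have h1 : (((n + 1 : ℕ) : ℝ) + K) ≤ (1 + K⁻¹) * (n + K) := by
      have h2 : 0 ≤ K⁻¹ * n := by positivity
      have h3 : K⁻¹ * K = 1 := inv_mul_cancel₀ hK0.ne'
      push_cast
      nlinarith
    calc (((n + 1 : ℕ) : ℝ) + K) ^ 4 / 2 ^ (n + 1) ≤ ((1 + K⁻¹) * (n + K)) ^ 4 / 2 ^ (n + 1) := by
          gcongr
      _ = _ := by field_simp; ring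
  · rw [← Real.mul_rpow (by positivity) (by positivity)]
    refine Real.rpow_le_rpow (by positivity) ?_ (by positivity)
    calc 1 / 2 * ((n + K) ^ 4 / 2 ^ n) = (n + K) ^ 4 / 2 ^ (n + 1) := by
          field_simp; ring
      _ ≤ _ := by
          gcongr
          linarith
  · rw [← Real.rpow_mul (by positivity), one_div_mul_cancel hd0.ne', Real.rpow_one]
    field_simp

theorem tendsto_two_pow_mul_rpow {s : ℕ → ℝ} (hs0 : ∀ n, 0 < s n) {ρ : ℝ} (hρ : 0 < ρ)
    (hρ1 : ρ < 1) (hs : ∀ n, s (n + 1) ≤ ρ * s n) {d e K : ℝ} (hK : 0 ≤ K)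
    (hsd : ∀ n : ℕ, 2 ^ n * s n ^ d = (n + K) ^ 4) (hde : d < e) :
    Tendsto (fun n => 2 ^ n * s n ^ e) atTop (nhds 0) := by
  set r := ρ ^ (e - d) with hr
  have hr0 : 0 < r := by positivity
  have hr1 : r < 1 := Real.rpow_lt_one hρ.le hρ1 (by linarith)
  have hlim : Tendsto (fun n : ℕ => (1 + K) ^ 4 * s 0 ^ (e - d) * r⁻¹ *
      (((n + 1 : ℕ) : ℝ) ^ 4 * r ^ (n + 1))) atTop (nhds 0) := by
    have h1 := (tendsto_pow_const_mul_const_pow_of_lt_one 4 hr0.le hr1).comp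
      (tendsto_add_atTop_nat 1)
    simpa using h1.const_mul ((1 + K) ^ 4 * s 0 ^ (e - d) * r⁻¹)
  refine squeeze_zero (fun n => ?_) (fun n => ?_) hlim
  · have := hs0 n
    positivity
  · have hsn : s n ≤ s 0 * ρ ^ n := by simpa using le_mul_pow_of_ratio hρ.le hs 0 n
    have h1 : s n ^ (e - d) ≤ s 0 ^ (e - d) * r ^ n := by
      refine (Real.rpow_le_rpow (hs0 n).le hsn (by linarith)).trans (le_of_eq ?_)
      rw [Real.mul_rpow (hs0 0).le (by positivity), hr, ← Real.rpow_natCast, ← Real.rpow_natCast,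
        ← Real.rpow_mul hρ.le, ← Real.rpow_mul hρ.le, mul_comm (e - d)]
    have h2 : (n + K : ℝ) ≤ (1 + K) * (n + 1) := by
      nlinarith [mul_nonneg hK (n.cast_nonneg (α := ℝ))]
    calc 2 ^ n * s n ^ e = 2 ^ n * s n ^ d * s n ^ (e - d) := by
          rw [mul_assoc, ← Real.rpow_add (hs0 n)]; simp
      _ ≤ ((1 + K) * (n + 1)) ^ 4 * (s 0 ^ (e - d) * r ^ n) := by
          rw [hsd]
          have := (hs0 n).le
          gcongr
      _ = _ := by
          push_cast
          field_simp
          ring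

/-- For every `1 < q < 2` there is a uniformly perfect compact set
`E ⊂ ℂ` with `C_q(E) > 0` and `C_{q'}(E) = 0` for every `1 < q' < q`. -/
theorem exists_uniformlyPerfect_capacity_threshold (q : ℝ) (hq1 : 1 < q) (hq2 : q < 2) :
    ∃ E : Set ℂ, IsCompact E ∧
      (∃ c > (0:ℝ), ∃ r₀ > (0:ℝ), ∀ a ∈ E, ∀ r : ℝ, 0 < r → r < r₀ →
        (E ∩ {z : ℂ | c * r ≤ dist z a ∧ dist z a ≤ r}).Nonempty) ∧
      0 < capacity q E ∧
      ∀ q' : ℝ, 1 < q' → q' < q → capacity q' E = 0 := by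
  obtain ⟨s, ρ, c, K, hs0, hρ, hρ1, hc0, hK, hs, hcs, hsd⟩ :=
    exists_digit_sizes (d := 2 - q) (by linarith) (by linarith)
  have hsum := summable_of_ratio hs0 hρ (by linarith) hs
  have hE := isCompact_cantorDigitSet hs0 hsum
  refine ⟨cantorDigitSet s, hE, ⟨c, hc0, s 0, hs0 0, fun a ha r hr hr0 =>
    cantorDigitSet_uniformlyPerfect hs0 hsum hc0 hcs ha hr hr0⟩, ?_, fun q' hq1' hq' => ?_⟩
  · have hsq : ∀ n : ℕ, s n ^ (q - 2) * (2 ^ n)⁻¹ ≤ ((n + 1 : ℝ) ^ 4)⁻¹ := by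
      intro n
      have h1 : s n ^ (q - 2) * (2 ^ n)⁻¹ = ((n + K) ^ 4)⁻¹ := by
        rw [← hsd n, ← neg_sub, Real.rpow_neg (hs0 n).le, mul_inv, mul_comm]
      rw [h1]
      gcongr
    obtain ⟨ε, hε, h⟩ := exists_le_integral_norm_fderiv_rpow hq1 hq2 hs0
      (fun n => by nlinarith [hs n, hs0 n]) hsum.tendsto_atTop_zero hc0 hcs hsq
    exact hε.trans_le (le_capacity hE fun φ hφ hc h1 =>
      h φ (hφ.of_le (by simp)) hc fun S => h1 _ (sum_mem_cantorDigitSet s S))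
  · obtain ⟨A, hA⟩ := exists_capacity_cantorDigitSet_le hs0 hρ hρ1 hs (p := q') (by linarith)
    have hlim := (tendsto_two_pow_mul_rpow hs0 hρ (by linarith) hs (by linarith) hsd
      (e := 2 - q') (by linarith)).const_mul A
    rw [mul_zero] at hlim
    exact le_antisymm (ge_of_tendsto' hlim hA) (capacity_nonneg _ _)
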